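/- Let X ⊆ ℝⁿ be the underlying polyhedron of a finite simplicial complex, with 0 ∈ X, let f : X → ℝ be a piecewise linear function with f(0) = 0, and for i ∈ {1,2} let d_i : X → ℝ be a nonnegative piecewise linear function whose zero set is exactly {0}. Set N_i(a,r) = {x ∈ X : d_i(x) ≤ r, f(x) = a}. Then for 0 < a ≪ r ≪ 1, the sets N₁(a,r) and N₂(a,r) are piecewise linearly homeomorphic, i.e. there is a homeomorphism between them whose graph is a semilinear set. -/

import Mathlib

noncomputable section
open Classical

namespace PLMilnor

/-- Semilinear subsets of `ℝ^ι`: the Boolean algebra generated by the sets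
`{x | L(x) > 0}` for affine functions `L`. -/
inductive IsSL (ι : Type) : Set (ι → ℝ) → Prop
  | basic (L : (ι → ℝ) →ᵃ[ℝ] ℝ) : IsSL ι {x | 0 < L x}
  | compl {s : Set (ι → ℝ)} : IsSL ι s → IsSL ι sᶜ
  | union {s t : Set (ι → ℝ)} : IsSL ι s → IsSL ι t → IsSL ι (s ∪ t)

/-- `K'` is a simplicial subdivision of `K`: same underlying polyhedron, and every
simplex of `K'` is contained in a simplex of `K`. -/
def IsSubdivision {n : ℕ} (K K' : Geometry.SimplicialComplex ℝ (Fin n → ℝ)) : Prop :=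
  K'.space = K.space ∧
  ∀ s ∈ K'.faces, ∃ t ∈ K.faces,
    convexHull ℝ (s : Set (Fin n → ℝ)) ⊆ convexHull ℝ (t : Set (Fin n → ℝ))

/-- `f` is piecewise linear on (the underlying polyhedron of) `K`: it is continuous
and affine on each simplex of some finite simplicial subdivision of `K`. -/
def IsPLOn {n : ℕ} (K : Geometry.SimplicialComplex ℝ (Fin n → ℝ))
    (f : (Fin n → ℝ) → ℝ) : Prop :=
  ContinuousOn f K.space ∧
  ∃ K' : Geometry.SimplicialComplex ℝ (Fin n → ℝ), K'.faces.Finite ∧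
    IsSubdivision K K' ∧
    ∀ s ∈ K'.faces, ∃ L : (Fin n → ℝ) →ᵃ[ℝ] ℝ,
      ∀ x ∈ convexHull ℝ (s : Set (Fin n → ℝ)), f x = L x

/-- `A` and `B` are piecewise linearly homeomorphic: there is a homeomorphism
between them whose graph is a semilinear set. -/
def IsPLHomeo {n : ℕ} (A B : Set (Fin n → ℝ)) : Prop :=
  ∃ φ ψ : (Fin n → ℝ) → (Fin n → ℝ),
    Set.MapsTo φ A B ∧ Set.MapsTo ψ B A ∧
    (∀ x ∈ A, ψ (φ x) = x) ∧ (∀ y ∈ B, φ (ψ y) = y) ∧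
    ContinuousOn φ A ∧ ContinuousOn ψ B ∧
    IsSL (Fin n ⊕ Fin n) {z | (fun i => z (Sum.inl i)) ∈ A ∧
      (fun j => z (Sum.inr j)) = φ (fun i => z (Sum.inl i))}


section SL
variable {ι κ : Type}

theorem IsSL.inter {s t : Set (ι → ℝ)} (hs : IsSL ι s) (ht : IsSL ι t) : IsSL ι (s ∩ t) := by
  have := (hs.compl.union ht.compl).compl
  rwa [Set.compl_union, compl_compl, compl_compl] at this

theorem IsSL.univ : IsSL ι Set.univ := by
  have h := IsSL.basic (ι := ι) (AffineMap.const ℝ _ 0)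
  have := h.union h.compl
  rwa [Set.union_compl_self] at this

theorem IsSL.empty : IsSL ι ∅ := by
  have := (IsSL.univ (ι := ι)).compl
  rwa [Set.compl_univ] at this

theorem IsSL.iUnion {α : Type} [Finite α] {S : α → Set (ι → ℝ)} (h : ∀ i, IsSL ι (S i)) :
    IsSL ι (⋃ i, S i) := by
  have := Fintype.ofFinite α
  have key : ∀ s : Finset α, IsSL ι (⋃ i ∈ s, S i) := by
    intro s
    induction s using Finset.induction_on with
    | empty => simpa using IsSL.empty
    | insert a s ha ih =>
      rw [Finset.set_biUnion_insert]
      exact (h a).union ih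
  simpa using key Finset.univ

theorem IsSL.iInter {α : Type} [Finite α] {S : α → Set (ι → ℝ)} (h : ∀ i, IsSL ι (S i)) :
    IsSL ι (⋂ i, S i) := by
  have := (IsSL.iUnion (fun i => (h i).compl)).compl
  simpa using this

theorem IsSL.preimage {s : Set (ι → ℝ)} (h : IsSL ι s) (A : (κ → ℝ) →ᵃ[ℝ] (ι → ℝ)) :
    IsSL κ {x | A x ∈ s} := by
  induction h with
  | basic L => exact IsSL.basic (L.comp A)
  | compl _ ih => exact ih.compl
  | union _ _ ih1 ih2 => exact ih1.union ih2

theorem IsSL.sign {s : Set (ι → ℝ)} (h : IsSL ι s) :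
    ∃ F : Finset ((ι → ℝ) →ᵃ[ℝ] ℝ), ∀ x y, (∀ M ∈ F, (0 < M x ↔ 0 < M y)) → (x ∈ s ↔ y ∈ s) := by
  induction h with
  | basic L => exact ⟨{L}, fun x y h => h L (by simp)⟩
  | compl _ ih =>
    obtain ⟨F, hF⟩ := ih
    exact ⟨F, fun x y h => not_congr (hF x y h)⟩
  | union _ _ ih1 ih2 =>
    obtain ⟨F, hF⟩ := ih1
    obtain ⟨G, hG⟩ := ih2
    exact ⟨F ∪ G, fun x y h => or_congr
      (hF x y fun M hM => h M (Finset.mem_union_left _ hM))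
      (hG x y fun M hM => h M (Finset.mem_union_right _ hM))⟩

/-- the root along direction `v` of `M`. -/
def rootv (v : ι → ℝ) (M : (ι → ℝ) →ᵃ[ℝ] ℝ) : (ι → ℝ) →ᵃ[ℝ] ℝ :=
  (-(M.linear v)⁻¹) • M

theorem aff_line (M : (ι → ℝ) →ᵃ[ℝ] ℝ) (x v : ι → ℝ) (t : ℝ) :
    M (x + t • v) = M x + t * M.linear v := by
  have := M.map_vadd x (t • v)
  simp only [vadd_eq_add, map_smul, smul_eq_mul] at this
  rw [add_comm, this, add_comm]

theorem IsSL.proj_vec {s : Set (ι → ℝ)} (h : IsSL ι s) (v : ι → ℝ) :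
    IsSL ι {x | ∃ t : ℝ, x + t • v ∈ s} := by
  obtain ⟨F, hF⟩ := h.sign
  let F' := F.filter (fun M => M.linear v ≠ 0)
  let R := F'.image (rootv v)
  let C : ℝ → ((ι → ℝ) →ᵃ[ℝ] ℝ) := fun c => AffineMap.const ℝ _ c
  let Θ : Finset ((ι → ℝ) →ᵃ[ℝ] ℝ) :=
    {C 0} ∪ R ∪ R.image (fun p => p + C 1) ∪ R.image (fun p => p - C 1) ∪
      (R ×ˢ R).image (fun p => (1/2 : ℝ) • (p.1 + p.2))
  have hset : {x | ∃ t : ℝ, x + t • v ∈ s} = ⋃ θ : Θ, {x | x + (θ.1 x) • v ∈ s} := by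
    ext x
    simp only [Set.mem_ofPred_eq, Set.mem_iUnion]
    constructor
    · rintro ⟨t, ht⟩
      suffices H : ∃ θ ∈ Θ, ∀ p ∈ R, (p x < t ↔ p x < θ x) ∧ (t < p x ↔ θ x < p x) by
        obtain ⟨θ, hθ, hp⟩ := H
        refine ⟨⟨θ, hθ⟩, (hF _ _ ?_).1 ht⟩
        intro M hM
        rw [aff_line, aff_line]
        by_cases h0 : M.linear v = 0
        · simp [h0]
        · have hmem : rootv v M ∈ R := Finset.mem_image_of_mem _ (by simp [F', hM, h0])
          obtain ⟨h1, h2⟩ := hp _ hmem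
          have e : M x = - (M.linear v) * rootv v M x := by
            simp [rootv]; field_simp
          simp only
          rw [e]
          have e1 : ∀ u : ℝ, -(M.linear v) * rootv v M x + u * M.linear v =
            M.linear v * (u - rootv v M x) := fun u => by ring
          rw [e1, e1]
          rcases lt_or_gt_of_ne h0 with hn | hn
          · have e2 : ∀ u : ℝ, 0 < M.linear v * (u - rootv v M x) ↔ u < rootv v M x := fun u => by
              constructor
              · intro h
                by_contra hc
                nlinarith
              · intro h
                nlinarith
            rw [e2, e2]
            exact h2
          · rw [mul_pos_iff_of_pos_left hn, mul_pos_iff_of_pos_left hn, sub_pos, sub_pos]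
            exact h1
      by_cases hroot : ∃ p ∈ R, p x = t
      · obtain ⟨p, hp, rfl⟩ := hroot
        exact ⟨p, by simp only [Θ, Finset.mem_union]; tauto, fun q _ => ⟨Iff.rfl, Iff.rfl⟩⟩
      push Not at hroot
      let lo := R.filter (fun p => p x < t)
      let hi := R.filter (fun p => t < p x)
      have hdich : ∀ p ∈ R, p ∈ lo ∨ p ∈ hi := fun p hp => by
        rcases lt_or_gt_of_ne (hroot p hp) with h | h
        · left; simp [lo, hp, h]
        · right; simp [hi, hp, h]
      have hlo' : ∀ p ∈ lo, p ∈ R ∧ p x < t := fun p hp => by simpa [lo] using hp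
      have hhi' : ∀ p ∈ hi, p ∈ R ∧ t < p x := fun p hp => by simpa [hi] using hp
      have fin : ∀ θ : (ι → ℝ) →ᵃ[ℝ] ℝ, (∀ p ∈ lo, p x < θ x) → (∀ p ∈ hi, θ x < p x) →
          ∀ p ∈ R, (p x < t ↔ p x < θ x) ∧ (t < p x ↔ θ x < p x) := by
        intro θ h1 h2 p hp
        rcases hdich p hp with h | h
        · have a := h1 p h
          have b := (hlo' p h).2
          exact ⟨⟨fun _ => a, fun _ => b⟩, ⟨fun h => by linarith, fun h => by linarith⟩⟩
        · have a := h2 p h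
          have b := (hhi' p h).2
          exact ⟨⟨fun h => by linarith, fun h => by linarith⟩, ⟨fun _ => a, fun _ => b⟩⟩
      rcases lo.eq_empty_or_nonempty with hl | hl <;> rcases hi.eq_empty_or_nonempty with hh | hh
      · exact ⟨C 0, by simp [Θ], fin _ (by simp [hl]) (by simp [hh])⟩
      · obtain ⟨q, hq, hmin⟩ := hi.exists_min_image (fun p => p x) hh
        refine ⟨q - C 1, ?_, fin _ (by simp [hl]) ?_⟩
        · have := (hhi' q hq).1
          simp only [Θ, Finset.mem_union, Finset.mem_image]
          exact Or.inl (Or.inr ⟨q, this, rfl⟩)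
        · intro p hp
          have := hmin p hp
          simp [C]; linarith
      · obtain ⟨q, hq, hmax⟩ := lo.exists_max_image (fun p => p x) hl
        refine ⟨q + C 1, ?_, fin _ ?_ (by simp [hh])⟩
        · have := (hlo' q hq).1
          simp only [Θ, Finset.mem_union, Finset.mem_image]
          exact Or.inl (Or.inl (Or.inr ⟨q, this, rfl⟩))
        · intro p hp
          have := hmax p hp
          simp [C]; linarith
      · obtain ⟨q, hq, hmin⟩ := hi.exists_min_image (fun p => p x) hh
        obtain ⟨q', hq', hmax⟩ := lo.exists_max_image (fun p => p x) hl
        have a1 := (hhi' q hq)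
        have a2 := (hlo' q' hq')
        refine ⟨(1/2 : ℝ) • (q' + q), ?_, fin _ ?_ ?_⟩
        · simp only [Θ, Finset.mem_union, Finset.mem_image]
          exact Or.inr ⟨(q', q), Finset.mem_product.2 ⟨a2.1, a1.1⟩, rfl⟩
        · intro p hp
          have := hmax p hp
          simp; linarith
        · intro p hp
          have := hmin p hp
          simp; linarith
    · rintro ⟨θ, h⟩
      exact ⟨_, h⟩
  rw [hset]
  refine IsSL.iUnion fun θ => ?_
  let A : (ι → ℝ) →ᵃ[ℝ] (ι → ℝ) :=
    AffineMap.id ℝ (ι → ℝ) + (((LinearMap.id : ℝ →ₗ[ℝ] ℝ).smulRight v).toAffineMap.comp θ.1)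
  have := h.preimage A
  simpa [A] using this

theorem IsSL.proj_sub [Finite ι] (V : Submodule ℝ (ι → ℝ)) :
    ∀ {s : Set (ι → ℝ)}, IsSL ι s → IsSL ι {x | ∃ v ∈ V, x + v ∈ s} := by
  have hV : V.FG := IsNoetherian.noetherian V
  induction V, hV using Submodule.fg_induction with
  | singleton v =>
    intro s hs
    have := hs.proj_vec v
    convert this using 3 with x
    simp [Submodule.mem_span_singleton]
  | sup V W _ _ ih1 ih2 =>
    intro s hs
    have := ih1 (ih2 hs)
    convert this using 3 with x
    constructor
    · rintro ⟨u, hu, hx⟩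
      obtain ⟨v, hv, w, hw, rfl⟩ := Submodule.mem_sup.1 hu
      exact ⟨v, hv, w, hw, by rwa [add_assoc]⟩
    · rintro ⟨v, hv, w, hw, hx⟩
      exact ⟨v + w, Submodule.add_mem_sup hv hw, by rwa [← add_assoc]⟩

theorem IsSL.exists_right [Finite ι] [Finite κ] {s : Set (ι ⊕ κ → ℝ)} (h : IsSL (ι ⊕ κ) s) :
    IsSL ι {x | ∃ w : κ → ℝ, Sum.elim x w ∈ s} := by
  let V : Submodule ℝ (ι ⊕ κ → ℝ) := LinearMap.ker (LinearMap.funLeft ℝ ℝ (Sum.inl : ι → ι ⊕ κ))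
  let A : (ι → ℝ) →ₗ[ℝ] (ι ⊕ κ → ℝ) :=
    LinearMap.pi (Sum.elim (fun i => LinearMap.proj i) (fun _ => 0))
  have hA : ∀ x, A x = Sum.elim x 0 := fun x => by
    ext i; rcases i with i | i <;> simp [A]
  have := (h.proj_sub V).preimage A.toAffineMap
  convert this using 3 with x
  simp only [LinearMap.coe_toAffineMap, hA]
  constructor
  · rintro ⟨w, hw⟩
    refine ⟨Sum.elim 0 w, ?_, ?_⟩
    · simp only [V, LinearMap.mem_ker]; ext i; simp [LinearMap.funLeft]
    · convert hw using 1
      ext i; rcases i with i | i <;> simp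
  · rintro ⟨v, hv, hx⟩
    refine ⟨fun k => v (Sum.inr k), ?_⟩
    convert hx using 1
    ext i; rcases i with i | i
    · have : v (Sum.inl i) = 0 := congrFun (LinearMap.mem_ker.1 hv) i
      simp [this]
    · simp

/-- piecewise affine functions with semilinear pieces -/
def PAF (g : (ι → ℝ) → ℝ) : Prop :=
  ∃ (α : Type) (_ : Finite α) (S : α → Set (ι → ℝ)) (L : α → ((ι → ℝ) →ᵃ[ℝ] ℝ)),
    (∀ i, IsSL ι (S i)) ∧ (∀ x, ∃ i, x ∈ S i) ∧ ∀ i, ∀ x ∈ S i, g x = L i x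

theorem PAF.aff (L : (ι → ℝ) →ᵃ[ℝ] ℝ) : PAF (fun x => L x) :=
  ⟨Unit, inferInstance, fun _ => Set.univ, fun _ => L, fun _ => IsSL.univ, fun x => ⟨(), trivial⟩,
    fun _ _ _ => rfl⟩

theorem PAF.const (c : ℝ) : PAF (fun _ : ι → ℝ => c) := PAF.aff (AffineMap.const ℝ _ c)

theorem PAF.coord (i : ι) : PAF (fun x : ι → ℝ => x i) :=
  PAF.aff (LinearMap.proj i : (ι → ℝ) →ₗ[ℝ] ℝ).toAffineMap

theorem PAF.comp {g : (ι → ℝ) → ℝ} (h : PAF g) (A : (κ → ℝ) →ₗ[ℝ] (ι → ℝ)) :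
    PAF (fun x => g (A x)) := by
  obtain ⟨α, hα, S, L, h1, h2, h3⟩ := h
  exact ⟨α, hα, fun i => {x | A x ∈ S i}, fun i => (L i).comp A.toAffineMap,
    fun i => (h1 i).preimage A.toAffineMap, fun x => h2 (A x), fun i x hx => h3 i _ hx⟩

theorem PAF.add {g h : (ι → ℝ) → ℝ} (hg : PAF g) (hh : PAF h) : PAF (fun x => g x + h x) := by
  obtain ⟨α, hα, S, L, h1, h2, h3⟩ := hg
  obtain ⟨α', hα', S', L', h1', h2', h3'⟩ := hh
  refine ⟨α × α', inferInstance, fun p => S p.1 ∩ S' p.2, fun p => L p.1 + L' p.2,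
    fun p => (h1 _).inter (h1' _), fun x => ?_, fun p x hx => ?_⟩
  · obtain ⟨i, hi⟩ := h2 x
    obtain ⟨j, hj⟩ := h2' x
    exact ⟨(i, j), hi, hj⟩
  · simp [h3 _ x hx.1, h3' _ x hx.2]

theorem PAF.smul {g : (ι → ℝ) → ℝ} (c : ℝ) (hg : PAF g) : PAF (fun x => c * g x) := by
  obtain ⟨α, hα, S, L, h1, h2, h3⟩ := hg
  exact ⟨α, hα, S, fun i => c • L i, h1, h2, fun i x hx => by simp [h3 i x hx]⟩

theorem PAF.neg {g : (ι → ℝ) → ℝ} (hg : PAF g) : PAF (fun x => - g x) := by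
  simpa using hg.smul (-1)

theorem PAF.sub {g h : (ι → ℝ) → ℝ} (hg : PAF g) (hh : PAF h) : PAF (fun x => g x - h x) := by
  simpa [sub_eq_add_neg] using hg.add hh.neg

theorem PAF.pos {g : (ι → ℝ) → ℝ} (hg : PAF g) : IsSL ι {x | 0 < g x} := by
  obtain ⟨α, hα, S, L, h1, h2, h3⟩ := hg
  have : {x | 0 < g x} = ⋃ i, S i ∩ {x | 0 < L i x} := by
    ext x
    simp only [Set.mem_ofPred_eq, Set.mem_iUnion, Set.mem_inter_iff]
    constructor
    · intro h
      obtain ⟨i, hi⟩ := h2 x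
      exact ⟨i, hi, by rwa [← h3 i x hi]⟩
    · rintro ⟨i, hi, h⟩
      rwa [h3 i x hi]
  rw [this]
  exact IsSL.iUnion fun i => (h1 i).inter (IsSL.basic _)

theorem PAF.lt {g h : (ι → ℝ) → ℝ} (hg : PAF g) (hh : PAF h) : IsSL ι {x | g x < h x} := by
  simpa using (hh.sub hg).pos

theorem PAF.le {g h : (ι → ℝ) → ℝ} (hg : PAF g) (hh : PAF h) : IsSL ι {x | g x ≤ h x} := by
  have := (hh.lt hg).compl
  simpa [Set.compl_def] using this

theorem PAF.eq {g h : (ι → ℝ) → ℝ} (hg : PAF g) (hh : PAF h) : IsSL ι {x | g x = h x} := by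
  have := (hg.le hh).inter (hh.le hg)
  convert this using 1
  ext x; exact le_antisymm_iff

theorem PAF.ite {g h : (ι → ℝ) → ℝ} (hg : PAF g) (hh : PAF h) {s : Set (ι → ℝ)} (hs : IsSL ι s) :
    PAF (fun x => if x ∈ s then g x else h x) := by
  obtain ⟨α, hα, S, L, h1, h2, h3⟩ := hg
  obtain ⟨α', hα', S', L', h1', h2', h3'⟩ := hh
  refine ⟨α ⊕ α', inferInstance, Sum.elim (fun i => S i ∩ s) (fun i => S' i ∩ sᶜ), Sum.elim L L',
    ?_, fun x => ?_, ?_⟩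
  · rintro (i | i)
    · exact (h1 i).inter hs
    · exact (h1' i).inter hs.compl
  · obtain ⟨i, hi⟩ := h2 x
    obtain ⟨j, hj⟩ := h2' x
    by_cases hx : x ∈ s
    · exact ⟨Sum.inl i, hi, hx⟩
    · exact ⟨Sum.inr j, hj, hx⟩
  · rintro (i | i) x ⟨hx, hxs⟩
    · refine (if_pos hxs).trans ?_; exact h3 i x hx
    · refine (if_neg hxs).trans ?_; exact h3' i x hx

theorem PAF.max {g h : (ι → ℝ) → ℝ} (hg : PAF g) (hh : PAF h) : PAF (fun x => max (g x) (h x)) := by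
  have := hh.ite hg (hg.le hh)
  convert this using 2 with x
  exact max_def _ _

theorem PAF.min {g h : (ι → ℝ) → ℝ} (hg : PAF g) (hh : PAF h) : PAF (fun x => min (g x) (h x)) := by
  have := hg.ite hh (hg.le hh)
  convert this using 2 with x
  exact min_def _ _

theorem PAF.abs {g : (ι → ℝ) → ℝ} (hg : PAF g) : PAF (fun x => |g x|) := hg.max hg.neg

theorem PAF.sum {α : Type} (s : Finset α) {g : α → (ι → ℝ) → ℝ} (h : ∀ a ∈ s, PAF (g a)) :
    PAF (fun x => ∑ a ∈ s, g a x) := by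
  induction s using Finset.induction_on with
  | empty => simpa using PAF.const 0
  | insert a s ha ih =>
    simp only [Finset.sum_insert ha]
    exact (h a (by simp)).add (ih fun b hb => h b (by simp [hb]))

theorem PAF.norm_sub [Fintype ι] (z : ι → ℝ) : PAF (fun x : ι → ℝ => ‖x - z‖) := by
  have key : ∀ s : Finset ι, PAF (fun x : ι → ℝ => ((s.sup fun b => ‖(x - z) b‖₊ : NNReal) : ℝ)) := by
    intro s
    induction s using Finset.induction_on with
    | empty => simpa using PAF.const 0
    | insert a s ha ih =>
      simp only [Finset.sup_insert]
      have := (((PAF.coord a).sub (PAF.const (z a))).abs).max ih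
      convert this using 2 with x
      rw [NNReal.coe_max, coe_nnnorm, Real.norm_eq_abs, Pi.sub_apply]
  simpa [Pi.norm_def] using key Finset.univ

end SL

section homeo
variable {n : ℕ}

theorem IsSL.inl {s : Set (Fin n → ℝ)} (h : IsSL (Fin n) s) :
    IsSL (Fin n ⊕ Fin n) {z | (fun i => z (Sum.inl i)) ∈ s} :=
  h.preimage (LinearMap.funLeft ℝ ℝ (Sum.inl : Fin n → Fin n ⊕ Fin n)).toAffineMap

theorem IsSL.inr {s : Set (Fin n → ℝ)} (h : IsSL (Fin n) s) :
    IsSL (Fin n ⊕ Fin n) {z | (fun i => z (Sum.inr i)) ∈ s} :=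
  h.preimage (LinearMap.funLeft ℝ ℝ (Sum.inr : Fin n → Fin n ⊕ Fin n)).toAffineMap

theorem isSL_funext_eq {ι κ : Type} [Finite κ] {g h : κ → (ι → ℝ) → ℝ} (hg : ∀ k, PAF (g k))
    (hh : ∀ k, PAF (h k)) : IsSL ι {x | (fun k => g k x) = (fun k => h k x)} := by
  have := IsSL.iInter (fun k => (hg k).eq (hh k))
  convert this using 1
  ext x
  simp [funext_iff]

theorem IsPLHomeo.refl {A : Set (Fin n → ℝ)} (hA : IsSL (Fin n) A) : IsPLHomeo A A := by
  refine ⟨id, id, Set.mapsTo_id _, Set.mapsTo_id _, fun _ _ => rfl, fun _ _ => rfl,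
    continuousOn_id, continuousOn_id, ?_⟩
  exact hA.inl.inter (isSL_funext_eq (fun i => PAF.coord _) (fun i => PAF.coord _))

theorem IsPLHomeo.trans {A B C : Set (Fin n → ℝ)} (h1 : IsPLHomeo A B) (h2 : IsPLHomeo B C) :
    IsPLHomeo A C := by
  obtain ⟨φ, ψ, a1, a2, a3, a4, a5, a6, a7⟩ := h1
  obtain ⟨φ', ψ', b1, b2, b3, b4, b5, b6, b7⟩ := h2
  refine ⟨φ' ∘ φ, ψ ∘ ψ', b1.comp a1, a2.comp b2, ?_, ?_, b5.comp a5 a1, a6.comp b6 b2, ?_⟩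
  · intro x hx
    simp [b3 _ (a1 hx), a3 x hx]
  · intro x hx
    simp [a4 _ (b2 hx), b4 x hx]
  · let p1 : Fin n ⊕ Fin n → (Fin n ⊕ Fin n) ⊕ Fin n :=
      Sum.elim (fun i => Sum.inl (Sum.inl i)) Sum.inr
    let p2 : Fin n ⊕ Fin n → (Fin n ⊕ Fin n) ⊕ Fin n :=
      Sum.elim Sum.inr (fun i => Sum.inl (Sum.inr i))
    have c1 := a7.preimage (LinearMap.funLeft ℝ ℝ p1).toAffineMap
    have c2 := b7.preimage (LinearMap.funLeft ℝ ℝ p2).toAffineMap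
    convert (c1.inter c2).exists_right using 1
    ext z
    simp only [Set.mem_ofPred_eq, Set.mem_inter_iff, LinearMap.coe_toAffineMap,
      LinearMap.funLeft_apply, p1, p2, Sum.elim_inl, Sum.elim_inr, Function.comp_apply]
    constructor
    · rintro ⟨h, h'⟩
      exact ⟨φ fun i => z (Sum.inl i), ⟨h, rfl⟩, a1 h, h'⟩
    · rintro ⟨w, ⟨h, h'⟩, h'', h3⟩
      refine ⟨h, ?_⟩
      rw [h3]
      exact congrArg φ' h'

theorem shear_exists {Y : Set (Fin n → ℝ)} {D D' : (Fin n → ℝ) → ℝ}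
    {z : Fin n → ℝ} {ε κ c : ℝ} (hκ : 0 < κ) (hc : 0 ≤ c) (hcz : c * ‖z‖ < κ)
    (hD' : ContinuousOn D' Y)
    (hinv : ∀ x ∈ Y, ∀ t : ℝ, ‖x - z‖ < ε → ‖x + t • z - z‖ < ε → x + t • z ∈ Y)
    (hmono' : ∀ x ∈ Y, ∀ t : ℝ, 0 ≤ t → ‖x - z‖ < ε → ‖x + t • z - z‖ < ε →
      D' x + κ * t ≤ D' (x + t • z))
    (hclose : ∀ x ∈ Y, |D' x - D x| ≤ c * max 0 (ε - ‖x - z‖)) (x : Fin n → ℝ) (hx : x ∈ Y) :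
    ∃ t : ℝ, κ * |t| ≤ c * max 0 (ε - ‖x - z‖) ∧ x + t • z ∈ Y ∧ D' (x + t • z) = D x := by
  by_cases hb : ε - ‖x - z‖ ≤ 0
  · have := hclose x hx
    rw [max_eq_left hb, mul_zero] at this
    have := abs_nonpos_iff.1 this
    exact ⟨0, by rw [max_eq_left hb]; simp, by simpa using hx, by simp; linarith⟩
  · push Not at hb
    set b := ε - ‖x - z‖ with hbdef
    have hmax : max 0 b = b := max_eq_right hb.le
    rw [hmax]
    have hxU : ‖x - z‖ < ε := by linarith
    let T := c * b / κ
    have hT0 : 0 ≤ T := by positivity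
    have hTκ : κ * T = c * b := by simp only [T]; field_simp
    have hU : ∀ t : ℝ, |t| ≤ T → ‖x + t • z - z‖ < ε := by
      intro t ht
      have h1 : ‖x + t • z - z‖ ≤ ‖x - z‖ + |t| * ‖z‖ := by
        have : x + t • z - z = (x - z) + t • z := by abel
        rw [this]
        refine (norm_add_le _ _).trans ?_
        rw [norm_smul, Real.norm_eq_abs]
      have h2 : |t| * ‖z‖ ≤ T * ‖z‖ := by gcongr
      have h3 : T * ‖z‖ < b := by
        have : κ * (T * ‖z‖) < κ * b := by
          rw [← mul_assoc, hTκ]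
          nlinarith
        exact lt_of_mul_lt_mul_left this hκ.le
      linarith
    have hY : ∀ t : ℝ, |t| ≤ T → x + t • z ∈ Y := fun t ht => hinv x hx t hxU (hU t ht)
    have hcont : ContinuousOn (fun t : ℝ => D' (x + t • z)) (Set.Icc (-T) T) := by
      refine hD'.comp (Continuous.continuousOn (by fun_prop)) ?_
      intro t ht
      exact hY t (abs_le.2 ht)
    have hcl := hclose x hx
    rw [hmax] at hcl
    have hcl' := abs_le.1 hcl
    have hhi : D x ≤ D' (x + T • z) := by
      have := hmono' x hx T hT0 hxU (hU T (by rw [abs_of_nonneg hT0]))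
      linarith
    have hlo : D' (x + (-T) • z) ≤ D x := by
      have hT' : |(-T)| ≤ T := by rw [abs_neg, abs_of_nonneg hT0]
      have := hmono' (x + (-T) • z) (hY _ hT') T hT0 (hU _ hT') (by simpa using hxU)
      simp only [neg_smul, neg_add_cancel_right] at this
      rw [neg_smul]
      linarith
    obtain ⟨t, ht, hte⟩ := intermediate_value_Icc (by linarith) hcont ⟨hlo, hhi⟩
    refine ⟨t, ?_, hY t (abs_le.2 ht), hte⟩
    rw [← hTκ]
    exact mul_le_mul_of_nonneg_left (abs_le.2 ht) hκ.le

theorem shear_inU {z x : Fin n → ℝ} {ε κ c t : ℝ} (hκ : 0 < κ) (hcz : c * ‖z‖ < κ)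
    (hb : ‖x - z‖ < ε) (ht : κ * |t| ≤ c * max 0 (ε - ‖x - z‖)) : ‖x + t • z - z‖ < ε := by
  have hb' : 0 < ε - ‖x - z‖ := by linarith
  rw [max_eq_right hb'.le] at ht
  have h1 : ‖x + t • z - z‖ ≤ ‖x - z‖ + |t| * ‖z‖ := by
    have : x + t • z - z = (x - z) + t • z := by abel
    rw [this]
    refine (norm_add_le _ _).trans ?_
    rw [norm_smul, Real.norm_eq_abs]
  have : κ * (|t| * ‖z‖) < κ * (ε - ‖x - z‖) := by
    have h2 := norm_nonneg z
    nlinarith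
  have := lt_of_mul_lt_mul_left this hκ.le
  linarith

theorem shear_uniq {Y : Set (Fin n → ℝ)} {D : (Fin n → ℝ) → ℝ}
    {z : Fin n → ℝ} {ε κ : ℝ} (hκ : 0 < κ)
    (hinv : ∀ x ∈ Y, ∀ t : ℝ, ‖x - z‖ < ε → ‖x + t • z - z‖ < ε → x + t • z ∈ Y)
    (hmono : ∀ x ∈ Y, ∀ t : ℝ, 0 ≤ t → ‖x - z‖ < ε → ‖x + t • z - z‖ < ε →
      D x + κ * t ≤ D (x + t • z))
    {x : Fin n → ℝ} (hx : x ∈ Y) {t : ℝ} (h1 : ‖x - z‖ < ε) (h2 : ‖x + t • z - z‖ < ε)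
    (he : D (x + t • z) = D x) : t = 0 := by
  rcases lt_trichotomy t 0 with h | h | h
  · have := hmono (x + t • z) (hinv x hx t h1 h2) (-t) (by linarith) h2 (by simpa using h1)
    simp only [neg_smul, add_neg_cancel_right] at this
    nlinarith
  · exact h
  · have := hmono x hx t h.le h1 h2
    nlinarith

theorem shear_uniq' {Y : Set (Fin n → ℝ)} {D : (Fin n → ℝ) → ℝ}
    {z : Fin n → ℝ} {ε κ c v : ℝ} (hκ : 0 < κ) (hcz : c * ‖z‖ < κ)
    (hinv : ∀ x ∈ Y, ∀ t : ℝ, ‖x - z‖ < ε → ‖x + t • z - z‖ < ε → x + t • z ∈ Y)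
    (hmono : ∀ x ∈ Y, ∀ t : ℝ, 0 ≤ t → ‖x - z‖ < ε → ‖x + t • z - z‖ < ε →
      D x + κ * t ≤ D (x + t • z))
    {x : Fin n → ℝ} {t t' : ℝ} (hY : x + t • z ∈ Y)
    (ht : κ * |t| ≤ c * max 0 (ε - ‖x - z‖)) (ht' : κ * |t'| ≤ c * max 0 (ε - ‖x - z‖))
    (he : D (x + t • z) = v) (he' : D (x + t' • z) = v) : t = t' := by
  by_cases hb : ‖x - z‖ < ε
  · have h1 := shear_inU hκ hcz hb ht
    have h2 := shear_inU hκ hcz hb ht'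
    have e : x + t' • z = (x + t • z) + (t' - t) • z := by
      rw [sub_smul]; abel
    rw [e] at h2 he'
    have := shear_uniq hκ hinv hmono hY h1 h2 (he'.trans he.symm)
    linarith
  · rw [max_eq_left (by linarith), mul_zero] at ht ht'
    have h1 : |t| ≤ 0 := by nlinarith [abs_nonneg t]
    have h2 : |t'| ≤ 0 := by nlinarith [abs_nonneg t']
    rw [abs_nonpos_iff.1 h1, abs_nonpos_iff.1 h2]

theorem shear_cont {Y : Set (Fin n → ℝ)} (hYc : IsCompact Y) {D D' : (Fin n → ℝ) → ℝ}
    {z : Fin n → ℝ} {ε κ c : ℝ} (hκ : 0 < κ) (hcz : c * ‖z‖ < κ)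
    (hD : ContinuousOn D Y) (hD' : ContinuousOn D' Y)
    (hinv : ∀ x ∈ Y, ∀ t : ℝ, ‖x - z‖ < ε → ‖x + t • z - z‖ < ε → x + t • z ∈ Y)
    (hmono' : ∀ x ∈ Y, ∀ t : ℝ, 0 ≤ t → ‖x - z‖ < ε → ‖x + t • z - z‖ < ε →
      D' x + κ * t ≤ D' (x + t • z))
    (τ : (Fin n → ℝ) → ℝ) (hτ : ∀ x ∈ Y, κ * |τ x| ≤ c * max 0 (ε - ‖x - z‖) ∧
      x + τ x • z ∈ Y ∧ D' (x + τ x • z) = D x) :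
    ContinuousOn τ Y := by
  have hYcl := hYc.isClosed
  obtain ⟨R, hR⟩ := hYc.isBounded.exists_norm_le
  intro x hx
  rw [ContinuousWithinAt, Filter.tendsto_iff_ultrafilter]
  intro 𝒰 h𝒰
  have hUY : ∀ᶠ y in (𝒰 : Filter (Fin n → ℝ)), y ∈ Y := h𝒰 self_mem_nhdsWithin
  have hUx : Filter.Tendsto id (𝒰 : Filter (Fin n → ℝ)) (nhds x) :=
    h𝒰.trans nhdsWithin_le_nhds
  let T := |c| * max 0 ε / κ
  have hbd : ∀ y ∈ Y, τ y ∈ Set.Icc (-T) T := by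
    intro y hy
    rw [Set.mem_Icc, ← abs_le]
    have h1 := (hτ y hy).1
    have h2 : c * max 0 (ε - ‖y - z‖) ≤ |c| * max 0 ε := by
      apply mul_le_mul (le_abs_self c) _ (le_max_left _ _) (abs_nonneg _)
      exact max_le_max le_rfl (by linarith [norm_nonneg (y - z)])
    rw [le_div_iff₀ hκ]
    linarith
  have hle : (𝒰.map τ : Filter ℝ) ≤ Filter.principal (Set.Icc (-T) T) := by
    rw [Filter.le_principal_iff]
    exact hUY.mono hbd
  obtain ⟨t, -, ht⟩ := isCompact_Icc.ultrafilter_le_nhds (𝒰.map τ) hle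
  have htt : Filter.Tendsto τ (𝒰 : Filter (Fin n → ℝ)) (nhds t) := ht
  have hlim : Filter.Tendsto (fun y => y + τ y • z) (𝒰 : Filter (Fin n → ℝ)) (nhds (x + t • z)) :=
    hUx.add (htt.smul_const z)
  have hmem : x + t • z ∈ Y := by
    refine hYcl.mem_of_tendsto hlim (hUY.mono fun y hy => (hτ y hy).2.1)
  have h1 : κ * |t| ≤ c * max 0 (ε - ‖x - z‖) := by
    have l1 : Filter.Tendsto (fun y => κ * |τ y|) (𝒰 : Filter (Fin n → ℝ)) (nhds (κ * |t|)) :=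
      (htt.abs).const_mul κ
    have l2 : Filter.Tendsto (fun y => c * max 0 (ε - ‖y - z‖)) (𝒰 : Filter (Fin n → ℝ))
        (nhds (c * max 0 (ε - ‖x - z‖))) := by
      have : Continuous (fun y : Fin n → ℝ => c * max 0 (ε - ‖y - z‖)) := by fun_prop
      exact (this.tendsto x).comp hUx
    exact le_of_tendsto_of_tendsto l1 l2 (hUY.mono fun y hy => (hτ y hy).1)
  have h2 : D' (x + t • z) = D x := by
    have l1 : Filter.Tendsto (fun y => D' (y + τ y • z)) (𝒰 : Filter (Fin n → ℝ))
        (nhds (D' (x + t • z))) := by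
      have := hD' _ hmem
      refine Filter.Tendsto.comp this (tendsto_nhdsWithin_iff.2 ⟨hlim, ?_⟩)
      exact hUY.mono fun y hy => (hτ y hy).2.1
    have l2 : Filter.Tendsto D (𝒰 : Filter (Fin n → ℝ)) (nhds (D x)) :=
      Filter.Tendsto.comp (hD x hx) h𝒰
    exact tendsto_nhds_unique_of_eventuallyEq l1 l2 (hUY.mono fun y hy => (hτ y hy).2.2)
  have h3 := hτ x hx
  rw [shear_uniq' hκ hcz hinv hmono' h3.2.1 h3.1 h1 h3.2.2 h2]
  exact ht

theorem shear {Y : Set (Fin n → ℝ)} (hYc : IsCompact Y) (hYs : IsSL (Fin n) Y)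
    {D D' : (Fin n → ℝ) → ℝ} {z : Fin n → ℝ} {ε κ c : ℝ} (r : ℝ)
    (hκ : 0 < κ) (hc : 0 ≤ c) (hcz : c * ‖z‖ < κ)
    (hD : ContinuousOn D Y) (hD' : ContinuousOn D' Y) (pD : PAF D) (pD' : PAF D')
    (hinv : ∀ x ∈ Y, ∀ t : ℝ, ‖x - z‖ < ε → ‖x + t • z - z‖ < ε → x + t • z ∈ Y)
    (hmono : ∀ x ∈ Y, ∀ t : ℝ, 0 ≤ t → ‖x - z‖ < ε → ‖x + t • z - z‖ < ε →
      D x + κ * t ≤ D (x + t • z))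
    (hmono' : ∀ x ∈ Y, ∀ t : ℝ, 0 ≤ t → ‖x - z‖ < ε → ‖x + t • z - z‖ < ε →
      D' x + κ * t ≤ D' (x + t • z))
    (hclose : ∀ x ∈ Y, |D' x - D x| ≤ c * max 0 (ε - ‖x - z‖)) :
    IsPLHomeo {x ∈ Y | D x ≤ r} {x ∈ Y | D' x ≤ r} := by
  have hclose' : ∀ x ∈ Y, |D x - D' x| ≤ c * max 0 (ε - ‖x - z‖) := fun x hx => by
    rw [abs_sub_comm]; exact hclose x hx
  have E1 := fun x hx => shear_exists hκ hc hcz hD' hinv hmono' hclose x hx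
  have E2 := fun x hx => shear_exists hκ hc hcz hD hinv hmono hclose' x hx
  choose! τ hτ using E1
  choose! σ hσ using E2
  have cτ := shear_cont hYc hκ hcz hD hD' hinv hmono' τ hτ
  have cσ := shear_cont hYc hκ hcz hD' hD hinv hmono σ hσ
  have comp : ∀ (D D' τ σ : (Fin n → ℝ) → ℝ) (_ : ∀ x ∈ Y, ∀ t : ℝ, 0 ≤ t → ‖x - z‖ < ε →
      ‖x + t • z - z‖ < ε → D x + κ * t ≤ D (x + t • z))
      (_ : ∀ x ∈ Y, κ * |τ x| ≤ c * max 0 (ε - ‖x - z‖) ∧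
      x + τ x • z ∈ Y ∧ D' (x + τ x • z) = D x)
      (_ : ∀ x ∈ Y, κ * |σ x| ≤ c * max 0 (ε - ‖x - z‖) ∧
      x + σ x • z ∈ Y ∧ D (x + σ x • z) = D' x), ∀ x ∈ Y,
      (x + τ x • z) + σ (x + τ x • z) • z = x := by
    intro D D' τ σ hmono hτ hσ x hx
    obtain ⟨a1, a2, a3⟩ := hτ x hx
    obtain ⟨b1, b2, b3⟩ := hσ _ a2
    by_cases hb : ‖x - z‖ < ε
    · have u1 := shear_inU hκ hcz hb a1
      have u2 := shear_inU hκ hcz u1 b1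
      have e : (x + τ x • z) + σ (x + τ x • z) • z = x + (τ x + σ (x + τ x • z)) • z := by
        rw [add_smul, add_assoc]
      rw [e] at u2 b3 ⊢
      have := shear_uniq hκ hinv hmono hx hb u2 (b3.trans a3)
      rw [this]; simp
    · have hm : max 0 (ε - ‖x - z‖) = 0 := max_eq_left (by linarith)
      have h1 : τ x = 0 := by
        rw [hm, mul_zero] at a1
        have : |τ x| ≤ 0 := by nlinarith [abs_nonneg (τ x)]
        exact abs_nonpos_iff.1 this
      simp only [h1, zero_smul, add_zero] at b1 ⊢
      rw [hm, mul_zero] at b1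
      have : |σ x| ≤ 0 := by nlinarith [abs_nonneg (σ x)]
      rw [abs_nonpos_iff.1 this]; simp
  refine ⟨fun x => x + τ x • z, fun x => x + σ x • z, ?_, ?_, ?_, ?_, ?_, ?_, ?_⟩
  · rintro x ⟨hx, hr⟩
    exact ⟨(hτ x hx).2.1, by rw [(hτ x hx).2.2]; exact hr⟩
  · rintro x ⟨hx, hr⟩
    exact ⟨(hσ x hx).2.1, by rw [(hσ x hx).2.2]; exact hr⟩
  · rintro x ⟨hx, hr⟩
    exact comp D D' τ σ hmono hτ hσ x hx
  · rintro x ⟨hx, hr⟩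
    exact comp D' D σ τ hmono' hσ hτ x hx
  · have : ContinuousOn (fun x => x + τ x • z) Y := continuousOn_id.add (cτ.smul continuousOn_const)
    exact this.mono fun x hx => hx.1
  · have : ContinuousOn (fun x => x + σ x • z) Y := continuousOn_id.add (cσ.smul continuousOn_const)
    exact this.mono fun x hx => hx.1
  · let q1 : ((Fin n ⊕ Fin n) ⊕ Unit → ℝ) →ₗ[ℝ] (Fin n → ℝ) :=
      LinearMap.funLeft ℝ ℝ (fun i => Sum.inl (Sum.inl i))
    let q2 : ((Fin n ⊕ Fin n) ⊕ Unit → ℝ) →ₗ[ℝ] (Fin n → ℝ) :=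
      LinearMap.funLeft ℝ ℝ (fun i => Sum.inl (Sum.inr i))
    let u : (Fin n ⊕ Fin n) ⊕ Unit := Sum.inr ()
    have pb : PAF (fun x : Fin n → ℝ => c * max 0 (ε - ‖x - z‖)) :=
      ((PAF.const 0).max ((PAF.const ε).sub (PAF.norm_sub z))).smul c
    have g1 := hYs.preimage q1.toAffineMap
    have g2 := (pD.comp q1).le (PAF.const r)
    have g3 := ((PAF.coord u).abs.smul κ).le (pb.comp q1)
    have g4 := hYs.preimage q2.toAffineMap
    have g5 := (pD'.comp q2).eq (pD.comp q1)
    have g6 : IsSL _ {w : (Fin n ⊕ Fin n) ⊕ Unit → ℝ |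
        (fun i => w (Sum.inl (Sum.inr i))) = fun i => w (Sum.inl (Sum.inl i)) + z i * w u} :=
      isSL_funext_eq (fun i => PAF.coord _)
        (fun i => (PAF.coord _).add ((PAF.coord u).smul (z i)))
    convert (g1.inter (g2.inter (g3.inter (g4.inter (g5.inter g6))))).exists_right using 1
    ext w
    simp only [Set.mem_ofPred_eq, Set.mem_inter_iff, LinearMap.coe_toAffineMap, q1, q2, u,
      Sum.elim_inl, Sum.elim_inr]
    have hfun : ∀ (f : (Fin n ⊕ Fin n → ℝ)) (w' : Unit → ℝ) ,
      LinearMap.funLeft ℝ ℝ (fun i : Fin n => (Sum.inl (Sum.inl i) : (Fin n ⊕ Fin n) ⊕ Unit))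
        (Sum.elim f w') = fun i => f (Sum.inl i) := fun f w' => rfl
    have hfun2 : ∀ (f : (Fin n ⊕ Fin n → ℝ)) (w' : Unit → ℝ) ,
      LinearMap.funLeft ℝ ℝ (fun i : Fin n => (Sum.inl (Sum.inr i) : (Fin n ⊕ Fin n) ⊕ Unit))
        (Sum.elim f w') = fun i => f (Sum.inr i) := fun f w' => rfl
    simp only [hfun, hfun2]
    set x : Fin n → ℝ := fun i => w (Sum.inl i) with hxdef
    set y : Fin n → ℝ := fun i => w (Sum.inr i) with hydef
    have hz : ∀ t : ℝ, (fun i => w (Sum.inl i) + z i * t) = x + t • z := fun t => by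
      ext i; simp [hxdef, mul_comm]
    constructor
    · rintro ⟨⟨h1, h2⟩, h3⟩
      refine ⟨fun _ => τ x, h1, h2, (hτ x h1).1, ?_, ?_, ?_⟩
      · rw [h3]; exact (hτ x h1).2.1
      · rw [h3]; exact (hτ x h1).2.2
      · rw [hz]; exact h3
    · rintro ⟨t, h1, h2, h3, h4, h5, h6⟩
      refine ⟨⟨h1, h2⟩, ?_⟩
      rw [hz] at h6
      obtain ⟨a1, a2, a3⟩ := hτ x h1
      rw [h6] at h4 h5
      rw [h6, shear_uniq' hκ hcz hinv hmono' h4 h3 a1 h5 a3]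

end homeo

section loc
variable {n : ℕ}

theorem isSL_convexHull (s : Finset (Fin n → ℝ)) :
    IsSL (Fin n) (convexHull ℝ (s : Set (Fin n → ℝ))) := by
  have g1 : IsSL (Fin n ⊕ s) (⋂ y : s, {p | (0:ℝ) ≤ p (Sum.inr y)}) :=
    IsSL.iInter fun y => (PAF.const 0).le (PAF.coord _)
  have g2 : IsSL (Fin n ⊕ s) {p | ∑ y : s, p (Sum.inr y) = 1} :=
    (PAF.sum _ fun y _ => PAF.coord _).eq (PAF.const 1)
  have g3 : IsSL (Fin n ⊕ s) {p | (fun i => ∑ y : s, y.1 i * p (Sum.inr y)) =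
      fun i => p (Sum.inl i)} :=
    isSL_funext_eq (fun i => PAF.sum _ fun y _ => (PAF.coord _).smul _) (fun i => PAF.coord _)
  convert (g1.inter (g2.inter g3)).exists_right using 1
  ext x
  rw [Finset.mem_convexHull']
  simp only [Set.mem_ofPred_eq, Set.mem_inter_iff, Set.mem_iInter, Sum.elim_inr, Sum.elim_inl]
  constructor
  · rintro ⟨w, h1, h2, h3⟩
    refine ⟨fun y => w y.1, fun y => h1 y.1 y.2, ?_, ?_⟩
    · rw [← h2]; exact Finset.sum_coe_sort s w
    · rw [← h3]
      ext i
      rw [Finset.sum_apply, ← Finset.sum_coe_sort s]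
      simp [mul_comm]
  · rintro ⟨w, h1, h2, h3⟩
    refine ⟨fun y => if h : y ∈ s then w ⟨y, h⟩ else 0, ?_, ?_, ?_⟩
    · intro y hy; simp [hy, h1]
    · rw [← h2, ← Finset.sum_coe_sort s]; simp
    · ext i
      rw [← congrFun h3 i, Finset.sum_apply, ← Finset.sum_coe_sort s]
      simp [mul_comm]

/-- `g` is affine on closed semilinear pieces covering `X`. -/
def PLX (X : Set (Fin n → ℝ)) (g : (Fin n → ℝ) → ℝ) : Prop :=
  ∃ (α : Type) (_ : Finite α) (S : α → Set (Fin n → ℝ)) (L : α → ((Fin n → ℝ) →ᵃ[ℝ] ℝ)),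
    (∀ i, IsSL (Fin n) (S i)) ∧ (∀ i, IsClosed (S i)) ∧ (∀ i, ∀ x ∈ S i, g x = L i x) ∧
    X = ⋃ i, S i

theorem IsPLOn.plx {K : Geometry.SimplicialComplex ℝ (Fin n → ℝ)} {g : (Fin n → ℝ) → ℝ}
    (h : IsPLOn K g) : PLX K.space g := by
  obtain ⟨-, K', hfin, ⟨hsp, -⟩, hL⟩ := h
  choose! L hL using hL
  have : Finite K'.faces := hfin
  refine ⟨K'.faces, inferInstance, fun s => convexHull ℝ (s.1 : Set (Fin n → ℝ)), fun s => L s.1,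
    fun s => isSL_convexHull _, fun s => ?_, fun s x hx => hL s.1 s.2 x hx, ?_⟩
  · exact (Set.Finite.isCompact_convexHull ℝ s.1.finite_toSet).isClosed
  · rw [← hsp]
    ext x
    simp [Geometry.SimplicialComplex.mem_space_iff]

theorem space_compact {K : Geometry.SimplicialComplex ℝ (Fin n → ℝ)} (h : K.faces.Finite) :
    IsCompact K.space := by
  exact h.isCompact_biUnion fun s _ => Set.Finite.isCompact_convexHull ℝ s.finite_toSet

theorem PLX.isSL {X : Set (Fin n → ℝ)} {g : (Fin n → ℝ) → ℝ} (h : PLX X g) : IsSL (Fin n) X := by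
  obtain ⟨α, _, S, L, h1, h2, h3, rfl⟩ := h
  exact IsSL.iUnion h1

theorem PLX.indicator {X : Set (Fin n → ℝ)} {g : (Fin n → ℝ) → ℝ} (h : PLX X g) :
    PLX X (X.indicator g) := by
  obtain ⟨α, hα, S, L, h1, h2, h3, rfl⟩ := h
  refine ⟨α, hα, S, L, h1, h2, fun i x hx => ?_, rfl⟩
  rw [Set.indicator_of_mem (Set.mem_iUnion.2 ⟨i, hx⟩), h3 i x hx]

theorem PLX.paf {X : Set (Fin n → ℝ)} {g : (Fin n → ℝ) → ℝ} (h : PLX X g) :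
    PAF (X.indicator g) := by
  obtain ⟨α, hα, S, L, h1, h2, h3, rfl⟩ := h
  refine ⟨Option α, inferInstance, fun o => o.elim (⋃ i, S i)ᶜ S,
    fun o => o.elim (AffineMap.const ℝ _ 0) L, ?_, ?_, ?_⟩
  · rintro (_ | i)
    · exact (IsSL.iUnion h1).compl
    · exact h1 i
  · intro x
    by_cases hx : x ∈ ⋃ i, S i
    · obtain ⟨i, hi⟩ := Set.mem_iUnion.1 hx
      exact ⟨some i, hi⟩
    · exact ⟨none, hx⟩
  · rintro (_ | i) x hx
    · exact Set.indicator_of_notMem hx g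
    · exact (Set.indicator_of_mem (Set.mem_iUnion.2 ⟨i, hx⟩) g).trans (h3 i x hx)

/-- local translation invariance -/
def Loc (X : Set (Fin n → ℝ)) (g : (Fin n → ℝ) → ℝ) (z : Fin n → ℝ) (ε : ℝ) : Prop :=
  ∀ x ∈ X, ∀ t : ℝ, ‖x - z‖ < ε → ‖x + t • z - z‖ < ε →
    x + t • z ∈ X ∧ g (x + t • z) = g x + t * g z

theorem PLX.loc {X : Set (Fin n → ℝ)} {g : (Fin n → ℝ) → ℝ} (h : PLX X g) (h0 : g 0 = 0) :
    ∃ ρ > (0 : ℝ), ∀ z, ‖z‖ < ρ → ∃ ε > (0 : ℝ), Loc X g z ε := by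
  obtain ⟨α, hα, S, L, h1, h2, h3, rfl⟩ := h
  choose F hF using fun i => (h1 i).sign
  have sg : ∀ (p : Fin n → ℝ) (M : (Fin n → ℝ) →ᵃ[ℝ] ℝ), M p ≠ 0 →
      ∀ᶠ x in nhds p, (0 < M x ↔ 0 < M p) ∧ M x ≠ 0 := by
    intro p M hM
    have hc : Filter.Tendsto M (nhds p) (nhds (M p)) :=
      (AffineMap.continuous_of_finiteDimensional M).tendsto p
    rcases lt_or_gt_of_ne hM with hl | hl
    · filter_upwards [hc.eventually (gt_mem_nhds hl)] with x hx
      exact ⟨⟨fun h => by linarith, fun h => by linarith⟩, hx.ne⟩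
    · filter_upwards [hc.eventually (lt_mem_nhds hl)] with x hx
      exact ⟨⟨fun _ => hl, fun _ => hx⟩, hx.ne'⟩
  have ev : ∀ p : Fin n → ℝ, ∀ᶠ x in nhds p,
      (∀ i, ∀ M ∈ F i, M p ≠ 0 → (0 < M x ↔ 0 < M p) ∧ M x ≠ 0) ∧ ∀ i, x ∈ S i → p ∈ S i := by
    intro p
    refine Filter.Eventually.and ?_ ?_
    · rw [Filter.eventually_all]
      intro i
      rw [Filter.eventually_all_finset]
      intro M _
      by_cases hM : M p = 0
      · simp [hM]
      · filter_upwards [sg p M hM] with x hx _ using hx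
    · rw [Filter.eventually_all]
      intro i
      by_cases hp : p ∈ S i
      · simp [hp]
      · filter_upwards [(h2 i).isOpen_compl.mem_nhds hp] with x hx hx'
        exact absurd hx' hx
  obtain ⟨ρ, hρ, hball⟩ := Metric.eventually_nhds_iff.1 (ev 0)
  refine ⟨ρ, hρ, fun z hz => ?_⟩
  obtain ⟨ε, hε, hzb⟩ := Metric.eventually_nhds_iff.1 (ev z)
  refine ⟨ε, hε, fun x hx t hxz hxt => ?_⟩
  have b0 := @hball z (by simpa [dist_eq_norm] using hz)
  have b1 := @hzb x (by simpa [dist_eq_norm] using hxz)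
  have b2 := @hzb (x + t • z) (by rwa [dist_eq_norm])
  obtain ⟨i, hi⟩ := Set.mem_iUnion.1 hx
  have hz_i := b1.2 i hi
  have h0_i := b0.2 i hz_i
  have lin : ∀ M : (Fin n → ℝ) →ᵃ[ℝ] ℝ, M 0 = 0 → M.linear z = M z := by
    intro M hM
    have := aff_line M 0 z 1
    simp [hM] at this
    exact this.symm
  have hxt_i : x + t • z ∈ S i := by
    refine (hF i x _ fun M hM => ?_).1 hi
    by_cases hMz : M z = 0
    · have hM0 : M 0 = 0 := by
        by_contra hne
        exact (b0.1 i M hM hne).2 hMz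
      rw [aff_line, lin M hM0, hMz]; simp
    · rw [(b1.1 i M hM hMz).1, (b2.1 i M hM hMz).1]
  refine ⟨Set.mem_iUnion.2 ⟨i, hxt_i⟩, ?_⟩
  have hL0 : L i 0 = 0 := by rw [← h3 i 0 h0_i, h0]
  rw [h3 i _ hxt_i, h3 i _ hi, h3 i _ hz_i, aff_line, lin _ hL0]

theorem Loc.mono {X : Set (Fin n → ℝ)} {g : (Fin n → ℝ) → ℝ} {z : Fin n → ℝ} {ε ε' : ℝ}
    (h : Loc X g z ε) (hε : ε' ≤ ε) : Loc X g z ε' :=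
  fun x hx t a b => h x hx t (a.trans_le hε) (b.trans_le hε)

end loc

section chain
variable {n : ℕ}

/-- truncation of `e` to `[-b, b]` -/
def clampf (b e : ℝ) : ℝ := max (-b) (min b e)

theorem clampf_sub {b b' e e' δ : ℝ} (h1 : |b - b'| ≤ δ) (h2 : |e - e'| ≤ δ) :
    |clampf b e - clampf b' e'| ≤ δ := by
  unfold clampf
  rw [abs_le] at *
  rcases max_cases (-b) (min b e) with h | h <;> rcases max_cases (-b') (min b' e') with h' | h' <;>
  rcases min_cases b e with g | g <;> rcases min_cases b' e' with g' | g' <;>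
  constructor <;> linarith [h1.1, h1.2, h2.1, h2.2, h.1, h.2, h'.1, h'.2, g.1, g.2, g'.1, g'.2]

theorem clampf_zero (e : ℝ) : clampf 0 e = 0 := by
  unfold clampf
  simp

theorem clampf_eq {b e : ℝ} (h : |e| ≤ b) : clampf b e = e := by
  unfold clampf
  rw [abs_le] at h
  rw [min_eq_right h.2, max_eq_right h.1]

theorem clampf_abs_le {b e : ℝ} (hb : 0 ≤ b) : |clampf b e| ≤ |e| := by
  have := clampf_sub (b := b) (b' := b) (e := e) (e' := 0) (δ := |e|) (by simp) (by simp)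
  rwa [clampf_eq (e := 0) (by simpa using hb), sub_zero] at this

/-- bump -/
def bump (ε : ℝ) (z x : Fin n → ℝ) : ℝ := max 0 (ε - ‖x - z‖)

theorem bump_nonneg (ε : ℝ) (z x : Fin n → ℝ) : 0 ≤ bump ε z x := le_max_left _ _

theorem bump_lip (ε : ℝ) (z x y : Fin n → ℝ) : |bump ε z x - bump ε z y| ≤ ‖x - y‖ := by
  unfold bump
  refine (abs_max_sub_max_le_max _ _ _ _).trans ?_
  simp only [sub_self, abs_zero]
  refine max_le (norm_nonneg _) ?_
  have : (ε - ‖x - z‖) - (ε - ‖y - z‖) = ‖y - z‖ - ‖x - z‖ := by ring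
  rw [this]
  refine (abs_norm_sub_norm_le _ _).trans ?_
  rw [norm_sub_rev x y]
  simp

/-- sum of bumps -/
def bsum (c : ℝ) (ε : (Fin n → ℝ) → ℝ) (U : Finset (Fin n → ℝ)) (x : Fin n → ℝ) : ℝ :=
  ∑ z ∈ U, c * bump (ε z) z x

theorem bsum_nonneg {c : ℝ} (hc : 0 ≤ c) (ε : (Fin n → ℝ) → ℝ) (U : Finset (Fin n → ℝ))
    (x : Fin n → ℝ) : 0 ≤ bsum c ε U x :=
  Finset.sum_nonneg fun z _ => mul_nonneg hc (bump_nonneg _ _ _)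

theorem bsum_lip {c : ℝ} (hc : 0 ≤ c) (ε : (Fin n → ℝ) → ℝ) (U : Finset (Fin n → ℝ))
    (x y : Fin n → ℝ) : |bsum c ε U x - bsum c ε U y| ≤ U.card * (c * ‖x - y‖) := by
  unfold bsum
  rw [← Finset.sum_sub_distrib]
  refine (Finset.abs_sum_le_sum_abs _ _).trans ?_
  rw [← nsmul_eq_mul]
  refine Finset.sum_le_card_nsmul _ _ _ fun z _ => ?_
  rw [← mul_sub, abs_mul, abs_of_nonneg hc]
  exact mul_le_mul_of_nonneg_left (bump_lip _ _ _ _) hc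

theorem bump_cont (ε : ℝ) (z : Fin n → ℝ) : Continuous (bump ε z) := by
  unfold bump; fun_prop

theorem bsum_cont (c : ℝ) (ε : (Fin n → ℝ) → ℝ) (U : Finset (Fin n → ℝ)) :
    Continuous (bsum c ε U) := by
  unfold bsum
  exact continuous_finset_sum _ fun z _ => (bump_cont _ _).const_mul c

theorem bsum_paf (c : ℝ) (ε : (Fin n → ℝ) → ℝ) (U : Finset (Fin n → ℝ)) :
    PAF (bsum c ε U) := by
  unfold bsum bump
  exact PAF.sum _ fun z _ => ((PAF.const 0).max ((PAF.const _).sub (PAF.norm_sub z))).smul c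

theorem clampf_paf {b e : (Fin n → ℝ) → ℝ} (hb : PAF b) (he : PAF e) :
    PAF (fun x => clampf (b x) (e x)) := hb.neg.max (hb.min he)

theorem clampf_cont {Y : Set (Fin n → ℝ)} {b e : (Fin n → ℝ) → ℝ} (hb : ContinuousOn b Y)
    (he : ContinuousOn e Y) : ContinuousOn (fun x => clampf (b x) (e x)) Y :=
  hb.neg.sup (hb.inf he)

theorem chain_step {Y : Set (Fin n → ℝ)} (hYc : IsCompact Y) (hYs : IsSL (Fin n) Y)
    {d e : (Fin n → ℝ) → ℝ} {ε : (Fin n → ℝ) → ℝ} {κ c : ℝ} (r : ℝ) (T : Finset (Fin n → ℝ))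
    (hκ : 0 < κ) (hc : 0 ≤ c) (hcz : ∀ z ∈ T, c * ‖z‖ < κ)
    (hcz' : ∀ z ∈ T, T.card * (c * ‖z‖) ≤ κ)
    (cd : ContinuousOn d Y) (ce : ContinuousOn e Y) (pd : PAF d) (pe : PAF e)
    (ld : ∀ z ∈ T, Loc Y d z (ε z)) (le : ∀ z ∈ T, Loc Y e z (ε z))
    (hd : ∀ z ∈ T, 2 * κ ≤ d z) (he : ∀ z ∈ T, |e z| ≤ κ) :
    IsPLHomeo {x ∈ Y | d x ≤ r} {x ∈ Y | d x + clampf (bsum c ε T x) (e x) ≤ r} := by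
  suffices H : ∀ U : Finset (Fin n → ℝ), U ⊆ T →
      IsPLHomeo {x ∈ Y | d x ≤ r} {x ∈ Y | d x + clampf (bsum c ε U x) (e x) ≤ r} from H T subset_rfl
  have mono : ∀ U : Finset (Fin n → ℝ), U ⊆ T → ∀ z ∈ T, ∀ x ∈ Y, ∀ t : ℝ, 0 ≤ t →
      ‖x - z‖ < ε z → ‖x + t • z - z‖ < ε z →
      (d x + clampf (bsum c ε U x) (e x)) + κ * t ≤
        d (x + t • z) + clampf (bsum c ε U (x + t • z)) (e (x + t • z)) := by
    intro U hU z hz x hx t ht h1 h2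
    have a1 := (ld z hz x hx t h1 h2).2
    have a2 := (le z hz x hx t h1 h2).2
    have a3 : |clampf (bsum c ε U x) (e x) -
        clampf (bsum c ε U (x + t • z)) (e (x + t • z))| ≤ κ * t := by
      apply clampf_sub
      · refine (bsum_lip hc ε U _ _).trans ?_
        have : ‖x - (x + t • z)‖ = t * ‖z‖ := by
          rw [sub_add_cancel_left, norm_neg, norm_smul, Real.norm_eq_abs, abs_of_nonneg ht]
        rw [this]
        have hcard : (U.card : ℝ) ≤ T.card := by exact_mod_cast Finset.card_le_card hU
        calc (U.card : ℝ) * (c * (t * ‖z‖)) = t * (U.card * (c * ‖z‖)) := by ring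
          _ ≤ t * (T.card * (c * ‖z‖)) := by gcongr
          _ ≤ t * κ := by gcongr; exact hcz' z hz
          _ = κ * t := mul_comm _ _
      · rw [a2, sub_add_cancel_left, abs_neg, abs_mul, abs_of_nonneg ht, mul_comm]
        exact mul_le_mul_of_nonneg_right (he z hz) ht
    rw [a1]
    have := (abs_le.1 a3).2
    have h3 := mul_le_mul_of_nonneg_left (hd z hz) ht
    nlinarith
  intro U
  induction U using Finset.induction_on with
  | empty =>
    intro _
    have : ∀ x : Fin n → ℝ, clampf (bsum c ε ∅ x) (e x) = 0 := fun x => by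
      simp [bsum, clampf_zero]
    simp only [this, add_zero]
    exact IsPLHomeo.refl (hYs.inter (pd.le (PAF.const r)))
  | insert z U hzU ih =>
    intro hU
    have hU' : U ⊆ T := (Finset.subset_insert _ _).trans hU
    have hz : z ∈ T := hU (Finset.mem_insert_self _ _)
    refine (ih hU').trans ?_
    refine shear hYc hYs (z := z) (ε := ε z) (κ := κ) (c := c) r hκ hc (hcz z hz)
      (cd.add (clampf_cont (bsum_cont _ _ _).continuousOn ce))
      (cd.add (clampf_cont (bsum_cont _ _ _).continuousOn ce))
      (pd.add (clampf_paf (bsum_paf _ _ _) pe)) (pd.add (clampf_paf (bsum_paf _ _ _) pe))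
      (fun x hx t h1 h2 => (ld z hz x hx t h1 h2).1) (mono U hU' z hz) (mono _ hU z hz) ?_
    intro x hx
    rw [add_sub_add_left_eq_sub]
    have hb : 0 ≤ c * bump (ε z) z x := mul_nonneg hc (bump_nonneg _ _ _)
    apply clampf_sub
    · unfold bsum
      rw [Finset.sum_insert hzU, add_sub_cancel_right, abs_of_nonneg hb]
      rfl
    · rw [sub_self, abs_zero]; exact hb

theorem assemble {X : Set (Fin n → ℝ)} (hXc : IsCompact X) (hXs : IsSL (Fin n) X)
    (f d₁ d₂ : (Fin n → ℝ) → ℝ)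
    (cf : ContinuousOn f X) (c1 : ContinuousOn d₁ X) (c2 : ContinuousOn d₂ X)
    (pf : PAF f) (p1 : PAF d₁) (p2 : PAF d₂)
    (hloc : ∃ ρ > (0 : ℝ), ∀ z, ‖z‖ < ρ → ∃ ε > (0 : ℝ), Loc X f z ε ∧ Loc X d₁ z ε ∧ Loc X d₂ z ε)
    (n1 : ∀ x ∈ X, 0 ≤ d₁ x) (n2 : ∀ x ∈ X, 0 ≤ d₂ x)
    (z1 : ∀ x ∈ X, (d₁ x = 0 ↔ x = 0)) (z2 : ∀ x ∈ X, (d₂ x = 0 ↔ x = 0)) :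
    ∃ r₀ > (0 : ℝ), ∀ r ∈ Set.Ioc (0 : ℝ) r₀, ∃ a₀ > (0 : ℝ),
      ∀ a ∈ Set.Ioc (0 : ℝ) a₀,
        IsPLHomeo {x ∈ {x ∈ X | f x = a} | d₁ x ≤ r} {x ∈ {x ∈ X | f x = a} | d₂ x ≤ r} := by
  -- positive lower bound for a continuous positive function on a compact set
  have lower : ∀ (Z : Set (Fin n → ℝ)) (g : (Fin n → ℝ) → ℝ), IsCompact Z → ContinuousOn g Z →
      (∀ x ∈ Z, 0 < g x) → ∃ m > (0:ℝ), ∀ x ∈ Z, m ≤ g x := by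
    intro Z g hZ hg hpos
    rcases Z.eq_empty_or_nonempty with rfl | hne
    · exact ⟨1, one_pos, by simp⟩
    · obtain ⟨x, hx, hmin⟩ := hZ.exists_isMinOn hne hg
      exact ⟨g x, hpos x hx, fun y hy => hmin hy⟩
  obtain ⟨ρ, hρ, hloc⟩ := hloc
  have pos1 : ∀ x ∈ X, x ≠ 0 → 0 < d₁ x := fun x hx h =>
    lt_of_le_of_ne (n1 x hx) fun h' => h ((z1 x hx).1 h'.symm)
  have pos2 : ∀ x ∈ X, x ≠ 0 → 0 < d₂ x := fun x hx h =>
    lt_of_le_of_ne (n2 x hx) fun h' => h ((z2 x hx).1 h'.symm)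
  obtain ⟨m, hm, hmX⟩ : ∃ m > (0:ℝ), ∀ x ∈ X, ρ / 2 ≤ ‖x‖ → m ≤ d₁ x ∧ m ≤ d₂ x := by
    have hZ : IsCompact (X ∩ {x | ρ / 2 ≤ ‖x‖}) :=
      hXc.inter_right (isClosed_le continuous_const continuous_norm)
    have hne : ∀ x ∈ X ∩ {x | ρ / 2 ≤ ‖x‖}, x ≠ 0 := by
      rintro x ⟨-, hx⟩ rfl
      simp only [Set.mem_ofPred_eq, norm_zero] at hx
      linarith
    obtain ⟨m1, hm1, h1⟩ := lower _ d₁ hZ (c1.mono Set.inter_subset_left)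
      fun x hx => pos1 x hx.1 (hne x hx)
    obtain ⟨m2, hm2, h2⟩ := lower _ d₂ hZ (c2.mono Set.inter_subset_left)
      fun x hx => pos2 x hx.1 (hne x hx)
    exact ⟨min m1 m2, lt_min hm1 hm2, fun x hx hn =>
      ⟨(min_le_left _ _).trans (h1 x ⟨hx, hn⟩), (min_le_right _ _).trans (h2 x ⟨hx, hn⟩)⟩⟩
  refine ⟨m / 4, by positivity, fun r hr => ?_⟩
  obtain ⟨hr0, hrm⟩ := hr
  -- the compact shell
  let W : Set (Fin n → ℝ) := {x ∈ X | ‖x‖ ≤ ρ / 2 ∧ r / 2 ≤ max (d₁ x) (d₂ x)}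
  have hWX : W ⊆ X := fun x hx => hx.1
  have hWc : IsCompact W := by
    have h1 : IsCompact (X ∩ {x | ‖x‖ ≤ ρ / 2}) :=
      hXc.inter_right (isClosed_le continuous_norm continuous_const)
    have h2 : ContinuousOn (fun x => max (d₁ x) (d₂ x)) (X ∩ {x | ‖x‖ ≤ ρ / 2}) :=
      (c1.sup c2).mono Set.inter_subset_left
    have h3 := h2.preimage_isClosed_of_isClosed h1.isClosed (isClosed_Ici (a := r / 2))
    have hWe : W = X ∩ {x | ‖x‖ ≤ ρ / 2} ∩ (fun x => max (d₁ x) (d₂ x)) ⁻¹' Set.Ici (r / 2) := by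
      ext x
      exact ⟨fun h => ⟨⟨h.1, h.2.1⟩, h.2.2⟩, fun h => ⟨h.1.1, h.1.2, h.2⟩⟩
    rw [← hWe] at h3
    exact h1.of_isClosed_subset h3 (fun x hx => ⟨hx.1, hx.2.1⟩)
  have hW0 : ∀ x ∈ W, x ≠ 0 := by
    rintro x ⟨hx, -, h⟩ rfl
    rw [(z1 0 hx).2 rfl, (z2 0 hx).2 rfl] at h
    simp at h; linarith
  choose! ε hε hlocε using fun z (hz : ‖z‖ < ρ) => hloc z hz
  let L : Set (Fin n → ℝ) := {x ∈ W | f x = 0}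
  have hLW : L ⊆ W := fun x hx => hx.1
  have hLc : IsCompact L := by
    have h3 := (cf.mono hWX).preimage_isClosed_of_isClosed hWc.isClosed (isClosed_singleton (x := 0))
    exact hWc.of_isClosed_subset h3 hLW
  have hLρ : ∀ z ∈ L, ‖z‖ < ρ := fun z hz => by
    have := hz.1.2.1
    linarith
  obtain ⟨T, hTL, hTcov⟩ := hLc.elim_nhds_subcover (fun z => Metric.ball z (ε z / 2))
    (fun z hz => Metric.ball_mem_nhds _ (by have := hε z (hLρ z hz); positivity))
  let G : Set (Fin n → ℝ) := ⋃ z ∈ T, Metric.ball z (ε z / 2)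
  have hG : IsOpen G := isOpen_biUnion fun z _ => Metric.isOpen_ball
  obtain ⟨a', ha', hfa⟩ := lower (W \ G) (fun x => |f x|) (hWc.diff hG)
    ((cf.mono (Set.diff_subset.trans hWX)).abs) (fun x hx => abs_pos.2 fun h =>
      hx.2 (hTcov ⟨hx.1, h⟩))
  refine ⟨a' / 2, by positivity, fun a ha => ?_⟩
  obtain ⟨ha0, ha1⟩ := ha
  have hYG : ∀ x ∈ W, f x = a → x ∈ G := by
    intro x hx hfx
    by_contra hc
    have := hfa x ⟨hx, hc⟩
    rw [hfx, abs_of_pos ha0] at this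
    linarith
  -- constants
  obtain ⟨β, hβ, hβT⟩ : ∃ β > (0:ℝ), ∀ z ∈ (T : Set (Fin n → ℝ)), β ≤ ε z / 2 :=
    lower T (fun z => ε z / 2) T.finite_toSet.isCompact (T.finite_toSet.continuousOn _)
      (fun z hz => by have := hε z (hLρ z (hTL z hz)); positivity)
  obtain ⟨κ, hκ, hκT⟩ : ∃ κ > (0:ℝ), ∀ z ∈ (T : Set (Fin n → ℝ)), κ ≤ min (d₁ z) (d₂ z) / 2 :=
    lower T _ T.finite_toSet.isCompact (T.finite_toSet.continuousOn _)
      (fun z hz => by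
        have hz' := hTL z hz
        have := lt_min (pos1 z (hWX (hLW hz')) (hW0 z (hLW hz')))
          (pos2 z (hWX (hLW hz')) (hW0 z (hLW hz')))
        positivity)
  obtain ⟨C, hC⟩ := hXc.exists_bound_of_continuousOn (c2.sub c1)
  obtain ⟨Zb, hZb⟩ := hXc.isBounded.exists_norm_le
  let Z' : ℝ := |Zb| + 1
  let c : ℝ := κ / ((T.card + 1) * Z')
  have hZ' : 0 < Z' := by positivity
  have hc : 0 < c := by positivity
  have hcc : (T.card + 1) * (c * Z') = κ := by simp only [c]; field_simp
  have hzZ : ∀ z ∈ T, ‖z‖ < Z' := fun z hz => by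
    have := hZb z (hWX (hLW (hTL z hz)))
    have := le_abs_self Zb
    simp only [Z']; linarith
  have hTc0 : (0:ℝ) ≤ T.card := Nat.cast_nonneg _
  have hcz : ∀ z ∈ T, c * ‖z‖ < κ := fun z hz => by
    have h1 : c * ‖z‖ < c * Z' := mul_lt_mul_of_pos_left (hzZ z hz) hc
    have h2 : 0 ≤ T.card * (c * Z') := by positivity
    linarith
  have hcz' : ∀ z ∈ T, T.card * (c * ‖z‖) ≤ κ := fun z hz => by
    have h1 : c * ‖z‖ ≤ c * Z' := (mul_lt_mul_of_pos_left (hzZ z hz) hc).le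
    have h2 : T.card * (c * ‖z‖) ≤ T.card * (c * Z') := mul_le_mul_of_nonneg_left h1 hTc0
    have h3 : 0 < c * Z' := by positivity
    linarith
  obtain ⟨q, hq, hqκ, hqβ, hqr⟩ : ∃ q > (0:ℝ), q ≤ κ ∧ q ≤ c * β ∧ q ≤ r / 2 :=
    ⟨min κ (min (c * β) (r / 2)), by positivity, min_le_left _ _,
      (min_le_right _ _).trans (min_le_left _ _), (min_le_right _ _).trans (min_le_right _ _)⟩
  obtain ⟨M0, hM0⟩ := exists_nat_gt (|C| / q)
  let M : ℝ := M0 + 1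
  have hM : 0 < M := by positivity
  have hCM : |C| / M ≤ q := by
    rw [div_le_iff₀ hM]
    rw [div_lt_iff₀ hq] at hM0
    simp only [M]; nlinarith
  let e : (Fin n → ℝ) → ℝ := fun x => M⁻¹ * (d₂ x - d₁ x)
  have heX : ∀ x ∈ X, |e x| ≤ q := fun x hx => by
    have h1 := hC x hx
    rw [Real.norm_eq_abs, Pi.sub_apply] at h1
    have h2 : |d₂ x - d₁ x| ≤ |C| := h1.trans (le_abs_self C)
    simp only [e]
    rw [abs_mul, abs_of_pos (inv_pos.2 hM), inv_mul_eq_div]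
    exact (div_le_div_of_nonneg_right h2 hM.le).trans hCM
  let Y : Set (Fin n → ℝ) := {x ∈ X | f x = a}
  have hYX : Y ⊆ X := fun x hx => hx.1
  have hYc : IsCompact Y :=
    hXc.of_isClosed_subset
      (cf.preimage_isClosed_of_isClosed hXc.isClosed (isClosed_singleton (x := a))) hYX
  have hYs : IsSL (Fin n) Y := hXs.inter (pf.eq (PAF.const a))
  let d : ℕ → (Fin n → ℝ) → ℝ := fun i x => d₁ x + (i / M) * (d₂ x - d₁ x)
  have dconv : ∀ i : ℕ, i ≤ M0 + 1 → ∀ x, min (d₁ x) (d₂ x) ≤ d i x ∧ d i x ≤ max (d₁ x) (d₂ x) := by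
    intro i hi x
    have hi0 : (0:ℝ) ≤ i / M := by positivity
    have hi1 : (i / M : ℝ) ≤ 1 := by
      rw [div_le_one hM]; simp only [M]; exact_mod_cast hi
    simp only [d]
    rcases le_total (d₁ x) (d₂ x) with h | h
    · rw [min_eq_left h, max_eq_right h]
      constructor <;> nlinarith
    · rw [min_eq_right h, max_eq_left h]
      constructor <;> nlinarith
  have locY : ∀ z ∈ T, ∀ x ∈ Y, ∀ t : ℝ, ‖x - z‖ < ε z → ‖x + t • z - z‖ < ε z →
      x + t • z ∈ Y ∧ d₁ (x + t • z) = d₁ x + t * d₁ z ∧ d₂ (x + t • z) = d₂ x + t * d₂ z := by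
    intro z hz x hx t h1 h2
    obtain ⟨l0, l1, l2⟩ := hlocε z (hLρ z (hTL z hz))
    have k0 := l0 x hx.1 t h1 h2
    refine ⟨⟨k0.1, ?_⟩, (l1 x hx.1 t h1 h2).2, (l2 x hx.1 t h1 h2).2⟩
    rw [k0.2, (hTL z hz).2, hx.2]; simp
  have step : ∀ i : ℕ, i < M0 + 1 → IsPLHomeo {x ∈ Y | d i x ≤ r} {x ∈ Y | d (i + 1) x ≤ r} := by
    intro i hi
    have cd : ContinuousOn (d i) Y :=
      (c1.add ((c2.sub c1).const_mul _)).mono hYX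
    have ce : ContinuousOn e Y := ((c2.sub c1).const_mul _).mono hYX
    have key := chain_step hYc hYs (d := d i) (e := e) (ε := ε) (κ := κ) (c := c) r T hκ hc.le hcz hcz'
      cd ce (p1.add ((p2.sub p1).smul _)) ((p2.sub p1).smul _)
      (fun z hz x hx t h1 h2 => by
        obtain ⟨l0, l1, l2⟩ := locY z hz x hx t h1 h2
        refine ⟨l0, ?_⟩
        simp only [d]; rw [l1, l2]; ring)
      (fun z hz x hx t h1 h2 => by
        obtain ⟨l0, l1, l2⟩ := locY z hz x hx t h1 h2
        refine ⟨l0, ?_⟩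
        simp only [e]; rw [l1, l2]; ring)
      (fun z hz => by
        have := hκT z hz
        have := (dconv i hi.le z).1
        linarith)
      (fun z hz => (heX z (hWX (hLW (hTL z hz)))).trans hqκ)
    convert key using 1
    ext x
    refine and_congr_right fun hx => ?_
    have hsucc : d (i + 1) x = d i x + e x := by
      simp only [d, e, Nat.cast_add, Nat.cast_one]; field_simp; ring
    rw [hsucc]
    have hex := heX x hx.1
    have hb0 := bsum_nonneg hc.le ε T x
    have hcl := (clampf_abs_le (e := e x) hb0).trans hex
    have hconv := dconv i hi.le x
    by_cases hn : ‖x‖ ≤ ρ / 2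
    · by_cases hmx : r / 2 ≤ max (d₁ x) (d₂ x)
      · have hxG : x ∈ G := hYG x ⟨hx.1, hn, hmx⟩ hx.2
        obtain ⟨z, hz, hxz⟩ := Set.mem_iUnion₂.1 hxG
        rw [Metric.mem_ball, dist_eq_norm] at hxz
        have hbz : β ≤ bump (ε z) z x := by
          have := hβT z hz
          refine le_trans ?_ (le_max_right _ _)
          linarith
        have hle : c * bump (ε z) z x ≤ bsum c ε T x :=
          Finset.single_le_sum (f := fun z => c * bump (ε z) z x)
            (fun w _ => mul_nonneg hc.le (bump_nonneg _ _ _)) hz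
        have hcb : c * β ≤ c * bump (ε z) z x := mul_le_mul_of_nonneg_left hbz hc.le
        rw [clampf_eq (by linarith)]
      · push Not at hmx
        have k1 := (abs_le.1 hex).2
        have k2 := (abs_le.1 hcl).2
        constructor <;> intro _ <;> linarith [hconv.2]
    · push Not at hn
      obtain ⟨k1, k2⟩ := hmX x hx.1 hn.le
      have k3 := le_min k1 k2
      have k4 := (abs_le.1 hex).1
      have k5 := (abs_le.1 hcl).1
      constructor <;> intro _ <;> linarith [hconv.1]
  have all : ∀ i : ℕ, i ≤ M0 + 1 → IsPLHomeo {x ∈ Y | d 0 x ≤ r} {x ∈ Y | d i x ≤ r} := by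
    intro i
    induction i with
    | zero =>
      intro _
      exact IsPLHomeo.refl (hYs.inter ((p1.add ((p2.sub p1).smul _)).le (PAF.const r)))
    | succ i ih =>
      intro hi
      exact (ih (by omega)).trans (step i (by omega))
  have fin := all (M0 + 1) le_rfl
  have e0 : d 0 = d₁ := by ext x; simp [d]
  have e1 : d (M0 + 1) = d₂ := by
    ext x
    have : ((M0 + 1 : ℕ) : ℝ) / M = 1 := by
      rw [Nat.cast_add, Nat.cast_one]; exact div_self hM.ne'
    simp only [d]; rw [this]; ring
  rw [e0, e1] at fin
  exact fin

end chain

/-- Lemma `lemPL`. Let `X` be the underlying polyhedron of a finite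
simplicial complex in `ℝⁿ` with `0 ∈ X`, `f` a piecewise linear function on `X` with
`f(0) = 0`, and `d₁, d₂` nonnegative piecewise linear functions on `X` with zero set
`{0}`. Then `N₁(a,r)` and `N₂(a,r)` are piecewise linearly homeomorphic for
`0 < a ≪ r ≪ 1`. -/
theorem statement14 {n : ℕ} (K : Geometry.SimplicialComplex ℝ (Fin n → ℝ))
    (hKfin : K.faces.Finite) (hX0 : (0 : Fin n → ℝ) ∈ K.space)
    (f : (Fin n → ℝ) → ℝ) (hf : IsPLOn K f) (hf0 : f 0 = 0)
    (d₁ d₂ : (Fin n → ℝ) → ℝ) (hd₁ : IsPLOn K d₁) (hd₂ : IsPLOn K d₂)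
    (hd₁0 : ∀ x ∈ K.space, 0 ≤ d₁ x) (hd₂0 : ∀ x ∈ K.space, 0 ≤ d₂ x)
    (hd₁z : ∀ x ∈ K.space, (d₁ x = 0 ↔ x = 0))
    (hd₂z : ∀ x ∈ K.space, (d₂ x = 0 ↔ x = 0)) :
    ∃ r₀ > (0 : ℝ), ∀ r ∈ Set.Ioc (0 : ℝ) r₀, ∃ a₀ > (0 : ℝ),
      ∀ a ∈ Set.Ioc (0 : ℝ) a₀,
        IsPLHomeo {x ∈ K.space | d₁ x ≤ r ∧ f x = a}
          {x ∈ K.space | d₂ x ≤ r ∧ f x = a} := by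
  have P0 := hf.plx
  have P1 := hd₁.plx
  have P2 := hd₂.plx
  have eqf : Set.EqOn (K.space.indicator f) f K.space := fun x hx => Set.indicator_of_mem hx f
  have eq1 : Set.EqOn (K.space.indicator d₁) d₁ K.space := fun x hx => Set.indicator_of_mem hx d₁
  have eq2 : Set.EqOn (K.space.indicator d₂) d₂ K.space := fun x hx => Set.indicator_of_mem hx d₂
  obtain ⟨ρ0, hρ0, l0⟩ := P0.indicator.loc (by rw [eqf hX0, hf0])
  obtain ⟨ρ1, hρ1, l1⟩ := P1.indicator.loc (by rw [eq1 hX0, (hd₁z 0 hX0).2 rfl])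
  obtain ⟨ρ2, hρ2, l2⟩ := P2.indicator.loc (by rw [eq2 hX0, (hd₂z 0 hX0).2 rfl])
  have main := assemble (space_compact hKfin) P0.isSL (K.space.indicator f) (K.space.indicator d₁)
    (K.space.indicator d₂) (hf.1.congr eqf) (hd₁.1.congr eq1) (hd₂.1.congr eq2) P0.paf P1.paf P2.paf
    ⟨min ρ0 (min ρ1 ρ2), by positivity, fun z hz => by
      obtain ⟨h0, h12⟩ := lt_min_iff.1 hz
      obtain ⟨h1, h2⟩ := lt_min_iff.1 h12
      obtain ⟨ε0, hε0, k0⟩ := l0 z h0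
      obtain ⟨ε1, hε1, k1⟩ := l1 z h1
      obtain ⟨ε2, hε2, k2⟩ := l2 z h2
      exact ⟨min ε0 (min ε1 ε2), by positivity, k0.mono (min_le_left _ _),
        k1.mono ((min_le_right _ _).trans (min_le_left _ _)),
        k2.mono ((min_le_right _ _).trans (min_le_right _ _))⟩⟩
    (fun x hx => by rw [eq1 hx]; exact hd₁0 x hx) (fun x hx => by rw [eq2 hx]; exact hd₂0 x hx)
    (fun x hx => by rw [eq1 hx]; exact hd₁z x hx) (fun x hx => by rw [eq2 hx]; exact hd₂z x hx)
  obtain ⟨r₀, hr₀, H⟩ := main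
  refine ⟨r₀, hr₀, fun r hr => ?_⟩
  obtain ⟨a₀, ha₀, H⟩ := H r hr
  refine ⟨a₀, ha₀, fun a ha => ?_⟩
  have h := H a ha
  have s1 : {x ∈ {x ∈ K.space | K.space.indicator f x = a} | K.space.indicator d₁ x ≤ r} =
      {x ∈ K.space | d₁ x ≤ r ∧ f x = a} := by
    ext x
    constructor
    · rintro ⟨⟨hx, h1⟩, h2⟩
      rw [eqf hx] at h1
      rw [eq1 hx] at h2
      exact ⟨hx, h2, h1⟩
    · rintro ⟨hx, h2, h1⟩
      exact ⟨⟨hx, by rw [eqf hx]; exact h1⟩, by rw [eq1 hx]; exact h2⟩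
  have s2 : {x ∈ {x ∈ K.space | K.space.indicator f x = a} | K.space.indicator d₂ x ≤ r} =
      {x ∈ K.space | d₂ x ≤ r ∧ f x = a} := by
    ext x
    constructor
    · rintro ⟨⟨hx, h1⟩, h2⟩
      rw [eqf hx] at h1
      rw [eq2 hx] at h2
      exact ⟨hx, h2, h1⟩
    · rintro ⟨hx, h2, h1⟩
      exact ⟨⟨hx, by rw [eqf hx]; exact h1⟩, by rw [eq2 hx]; exact h2⟩
  rwa [s1, s2] at h
end PLMilnor
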